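/- (Deterministic core of Corollary 1.) Let s ≥ 1, let A_i, C_i (1 ≤ i ≤ s) be real n×n matrices, P a symmetric positive definite real n×n matrix, and Q_i (1 ≤ i ≤ s) symmetric positive definite real n×n matrices such that (P A_i)^S + C_iᵀ P C_i + Q_i is negative definite for every i. Then for every x ∈ ℝⁿ with x ≠ 0 and every h ∈ ℝ^s with h_i ≥ 0 and Σ_{i=1}^s h_i = 1, Σ_{i=1}^s Σ_{j=1}^s h_i h_j · xᵀ [ P A_i + (1/2) C_iᵀ P C_j ]^S x < 0. -/

import Mathlib

open Matrix

/-- The quadratic form of `M + Mᵀ` is twice that of `M`. -/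
lemma dotProduct_add_transpose_mulVec {ι : Type*} [Fintype ι] (M : Matrix ι ι ℝ) (x : ι → ℝ) :
    x ⬝ᵥ (M + Mᵀ) *ᵥ x = 2 * (x ⬝ᵥ M *ᵥ x) := by
  have hT : x ⬝ᵥ Mᵀ *ᵥ x = x ⬝ᵥ M *ᵥ x := by
    rw [mulVec_transpose, dotProduct_comm, dotProduct_mulVec]
  rw [add_mulVec, dotProduct_add, hT, two_mul]

lemma dotProduct_transpose_mul_mul_mulVec {ι κ : Type*} [Fintype ι] [Fintype κ]
    (C D : Matrix κ ι ℝ) (P : Matrix κ κ ℝ) (x : ι → ℝ) :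
    x ⬝ᵥ (Cᵀ * P * D) *ᵥ x = (C *ᵥ x) ⬝ᵥ P *ᵥ (D *ᵥ x) := by
  rw [← mulVec_mulVec, ← mulVec_mulVec, dotProduct_mulVec, vecMul_transpose]

/-- The inequality `2 ⟨u, v⟩ ≤ ⟨u, u⟩ + ⟨v, v⟩` for the form of a positive semidefinite matrix. -/
lemma Matrix.PosSemidef.two_mul_dotProduct_mulVec_le {ι : Type*} [Fintype ι]
    {P : Matrix ι ι ℝ} (hP : P.PosSemidef) (u v : ι → ℝ) :
    2 * (u ⬝ᵥ P *ᵥ v) ≤ u ⬝ᵥ P *ᵥ u + v ⬝ᵥ P *ᵥ v := by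
  have hsymm : v ⬝ᵥ P *ᵥ u = u ⬝ᵥ P *ᵥ v := by
    have hT : Pᵀ = P := by simpa using hP.isHermitian.eq
    rw [dotProduct_comm, ← vecMul_transpose, hT, dotProduct_mulVec]
  have hnn := hP.dotProduct_mulVec_nonneg (u - v)
  simp only [star_trivial, mulVec_sub, dotProduct_sub, sub_dotProduct] at hnn
  linarith

/-- A double convex combination of `a i + c i j` is negative when every `a i + c i i` is and
`c i j` is bounded by the mean of `c i i` and `c j j`. -/
lemma sum_sum_mul_add_neg {ι : Type*} [Fintype ι] {a h : ι → ℝ} {c : ι → ι → ℝ}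
    (hc : ∀ i j, 2 * c i j ≤ c i i + c j j) (hac : ∀ i, a i + c i i < 0)
    (hnn : ∀ i, 0 ≤ h i) (hsum : ∑ i, h i = 1) :
    ∑ i, ∑ j, h i * h j * (a i + c i j) < 0 := by
  calc ∑ i, ∑ j, h i * h j * (a i + c i j)
      ≤ ∑ i, ∑ j, (h i * (a i + c i i / 2) * h j + h i * (h j * (c j j / 2))) := by
        gcongr with i _ j _
        nlinarith [mul_le_mul_of_nonneg_left (hc i j) (mul_nonneg (hnn i) (hnn j))]
    _ = ∑ i, h i * (a i + c i i) := by
        simp only [Finset.sum_add_distrib, ← Finset.mul_sum, ← Finset.sum_mul, hsum, mul_one,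
          one_mul]
        rw [← Finset.sum_add_distrib]
        exact Finset.sum_congr rfl fun i _ => by ring
    _ < 0 := by
        obtain ⟨i, -, hi⟩ := Finset.exists_ne_zero_of_sum_ne_zero (hsum.trans_ne one_ne_zero)
        exact Finset.sum_neg' (fun j _ => mul_nonpos_of_nonneg_of_nonpos (hnn j) (hac j).le)
          ⟨i, Finset.mem_univ i, mul_neg_of_pos_of_neg ((hnn i).lt_of_ne' hi) (hac i)⟩

/-- Deterministic core of Corollary 1: if `(P A_i)^S + C_iᵀ P C_i + Q_i < 0`
with `P, Q_i` symmetric positive definite, then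
`∑_{i,j} h_i h_j xᵀ[P A_i + ½ C_iᵀ P C_j]^S x < 0` for all `x ≠ 0` and all
convex-combination vectors `h`. -/
theorem stmt_15 (n s : ℕ) (hs : 1 ≤ s)
    (A C : Fin s → Matrix (Fin n) (Fin n) ℝ)
    (P : Matrix (Fin n) (Fin n) ℝ) (hP : P.PosDef)
    (Q : Fin s → Matrix (Fin n) (Fin n) ℝ) (hQ : ∀ i, (Q i).PosDef)
    (hneg : ∀ i, (-(P * A i + (P * A i)ᵀ + (C i)ᵀ * P * C i + Q i)).PosDef) :
    ∀ (x : Fin n → ℝ), x ≠ 0 → ∀ h : Fin s → ℝ, (∀ i, 0 ≤ h i) → (∑ i, h i = 1) →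
      ∑ i, ∑ j, h i * h j *
          (x ⬝ᵥ ((P * A i + (1/2 : ℝ) • ((C i)ᵀ * P * C j)
            + (P * A i + (1/2 : ℝ) • ((C i)ᵀ * P * C j))ᵀ).mulVec x))
        < 0 := by
  intro x hx h hnn hsum
  have key := sum_sum_mul_add_neg (a := fun i => 2 * (x ⬝ᵥ (P * A i) *ᵥ x))
    (c := fun i j => (C i *ᵥ x) ⬝ᵥ P *ᵥ (C j *ᵥ x))
    (fun i j => hP.posSemidef.two_mul_dotProduct_mulVec_le _ _) (fun i => ?_) hnn hsum
  · convert key using 6 with i _ j _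
    rw [dotProduct_add_transpose_mulVec, add_mulVec, dotProduct_add, smul_mulVec,
      dotProduct_smul, dotProduct_transpose_mul_mul_mulVec, smul_eq_mul]
    ring
  · have hi := (hneg i).dotProduct_mulVec_pos hx
    have hQi := (hQ i).dotProduct_mulVec_pos hx
    rw [star_trivial] at hi hQi
    rw [neg_mulVec, dotProduct_neg, add_mulVec, add_mulVec, dotProduct_add, dotProduct_add,
      dotProduct_add_transpose_mulVec, dotProduct_transpose_mul_mul_mulVec] at hi
    linarith
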